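/- arXiv:1911.09866 — 2 statements merged into one kernel-verified Lean document; each statement's English description precedes it below -/
import Mathlib

section
/- Let 1 ≤ b < n/2 − 1 and let T be an n-vertex chemical tree with exactly b branching vertices such that either M1(T') ≤ M1(T) for every n-vertex chemical tree T' with exactly b branching vertices, or M2(T') ≤ M2(T) for every n-vertex chemical tree T' with exactly b branching vertices. Then: (a) if n_2(T) > 0, then n_1(T) = 2b+2, n_2(T) = n−3b−2, n_3(T) = 0 and n_4(T) = b; (b) n_2(T) = 0 if and only if n_1(T) = n−b, n_3(T) = 3b−n+2 and n_4(T) = n−2b−2. -/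
open SimpleGraph

namespace ChemTree

variable {V : Type*}

/-- The degree of a vertex. -/
noncomputable def deg (G : SimpleGraph V) (v : V) : ℕ :=
  (G.neighborSet v).ncard

/-- A chemical tree: a tree in which every vertex has degree at most 4. -/
def IsChemicalTree (G : SimpleGraph V) : Prop :=
  G.IsTree ∧ ∀ v, deg G v ≤ 4

/-- `nDeg G i` is the number of vertices of `G` having degree `i`. -/
noncomputable def nDeg (G : SimpleGraph V) (i : ℕ) : ℕ :=
  {v | deg G v = i}.ncard

/-- The first Zagreb index. -/
noncomputable def M1 (G : SimpleGraph V) [Fintype V] : ℕ :=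
  ∑ v, (deg G v) ^ 2

/-- The second Zagreb index. -/
noncomputable def M2 (G : SimpleGraph V) [Fintype V] : ℕ :=
  ∑ e ∈ (Set.toFinite G.edgeSet).toFinset,
    Sym2.lift ⟨fun u w => deg G u * deg G w, fun u w => Nat.mul_comm _ _⟩ e

/-- A segment: a nontrivial path whose end vertices have degree `≠ 2` and whose
internal vertices all have degree `2`. -/
def IsSegment (G : SimpleGraph V) {u v : V} (p : G.Walk u v) : Prop :=
  p.IsPath ∧ 0 < p.length ∧ deg G u ≠ 2 ∧ deg G v ≠ 2 ∧
    ∀ w ∈ p.support, w ≠ u → w ≠ v → deg G w = 2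

/-- The number of segments: in a tree, a segment is uniquely determined by the
unordered pair of its end vertices. -/
noncomputable def numSegments (G : SimpleGraph V) : ℕ :=
  {s : Sym2 V | ∃ (u v : V) (p : G.Walk u v), s = s(u, v) ∧ IsSegment G p}.ncard

/-- The number of branching vertices (vertices of degree at least 3). -/
noncomputable def numBranching (G : SimpleGraph V) : ℕ :=
  {v | 3 ≤ deg G v}.ncard

/-- An internal path: both end vertices are branching and all internal vertices
have degree `2`. -/
def IsInternalPath (G : SimpleGraph V) {u v : V} (p : G.Walk u v) : Prop :=
  p.IsPath ∧ 0 < p.length ∧ 3 ≤ deg G u ∧ 3 ≤ deg G v ∧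
    ∀ w ∈ p.support, w ≠ u → w ≠ v → deg G w = 2

/-- A pendent path: one end vertex is pendent, the other is branching and all
internal vertices have degree `2`. -/
def IsPendentPath (G : SimpleGraph V) {u v : V} (p : G.Walk u v) : Prop :=
  p.IsPath ∧ 0 < p.length ∧ deg G u = 1 ∧ 3 ≤ deg G v ∧
    ∀ w ∈ p.support, w ≠ u → w ≠ v → deg G w = 2

end ChemTree

open ChemTree

namespace ChemTree

variable {V : Type*}

/-- The sum over the edges of `G` of the products of the labels of their end vertices. -/
noncomputable def edgeWeight [Finite V] (G : SimpleGraph V) (d : V → ℕ) : ℕ :=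
  ∑ e ∈ (Set.toFinite G.edgeSet).toFinset,
    Sym2.lift ⟨fun u w => d u * d w, fun u w => Nat.mul_comm _ _⟩ e

theorem M2_eq_edgeWeight [Fintype V] (G : SimpleGraph V) : M2 G = edgeWeight G (deg G) := rfl

theorem edgeWeight_update_add_one [Finite V] [DecidableEq V] (G : SimpleGraph V) (d : V → ℕ)
    (x : V) :
    edgeWeight G (Function.update d x (d x + 1)) =
      edgeWeight G d + ∑ y ∈ (Set.toFinite (G.neighborSet x)).toFinset, d y := by
  have key : ∀ e ∈ (Set.toFinite G.edgeSet).toFinset,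
      Sym2.lift ⟨fun u w => Function.update d x (d x + 1) u * Function.update d x (d x + 1) w,
        fun u w => Nat.mul_comm _ _⟩ e =
      Sym2.lift ⟨fun u w => d u * d w, fun u w => Nat.mul_comm _ _⟩ e +
        ∑ y ∈ (Set.toFinite (G.neighborSet x)).toFinset, if e = s(x, y) then d y else 0 := by
    intro e he
    induction e with | _ a b
    have hab : G.Adj a b := by simpa using he
    simp only [Sym2.lift_mk]
    by_cases ha : x = a
    · subst ha
      have hb : b ≠ x := hab.ne'
      simp [hb, hab, add_mul]
    · by_cases hb : x = b
      · subst hb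
        simp [Ne.symm ha, hab.symm, mul_add]
      · simp [Ne.symm ha, Ne.symm hb]
  unfold edgeWeight
  rw [Finset.sum_congr rfl key, Finset.sum_add_distrib, Finset.sum_comm]
  congr 1
  refine Finset.sum_congr rfl fun y hy => ?_
  have hy' : G.Adj x y := by simpa using hy
  rw [Finset.sum_ite_eq', if_pos (by simpa using hy')]

theorem edgeWeight_sup_edge [Finite V] (G : SimpleGraph V) (d : V → ℕ) {x y : V}
    (hxy : x ≠ y) (hG : ¬ G.Adj x y) :
    edgeWeight (G ⊔ edge x y) d = edgeWeight G d + d x * d y := by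
  classical
  have h : (Set.toFinite (G ⊔ edge x y).edgeSet).toFinset =
      insert s(x, y) (Set.toFinite G.edgeSet).toFinset := by
    ext e
    have hdiag : e = s(x, y) → ¬ e.IsDiag := by
      rintro rfl
      simpa using hxy
    simp [edgeSet_sup, edgeSet_edge, or_comm, and_iff_left_of_imp hdiag]
  unfold edgeWeight
  rw [h, Finset.sum_insert (by simpa using hG), Sym2.lift_mk, add_comm]

theorem sum_sq_update_add_one [Fintype V] [DecidableEq V] (d : V → ℕ) (x : V) :
    ∑ v, (Function.update d x (d x + 1) v) ^ 2 = ∑ v, d v ^ 2 + (2 * d x + 1) := by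
  have key : ∀ v, (Function.update d x (d x + 1) v) ^ 2 =
      d v ^ 2 + if v = x then 2 * d x + 1 else 0 := by
    intro v
    by_cases h : v = x
    · subst h
      simp
      ring
    · simp [h]
  simp [key, Finset.sum_add_distrib]

theorem deg_eq_degree [Fintype V] (G : SimpleGraph V) [DecidableRel G.Adj] (v : V) :
    deg G v = G.degree v := by
  rw [deg, Set.ncard_eq_toFinset_card', ← card_neighborFinset_eq_degree]
  rfl

theorem one_le_deg_of_adj [Finite V] {G : SimpleGraph V} {v w : V} (h : G.Adj v w) :
    1 ≤ deg G v :=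
  (Set.ncard_pos (Set.toFinite _)).2 ⟨w, h⟩

theorem one_le_deg_of_isTree [Finite V] [Nontrivial V] {G : SimpleGraph V} (h : G.IsTree)
    (v : V) : 1 ≤ deg G v := by
  obtain ⟨w, hw⟩ := h.connected.preconnected.exists_adj_of_nontrivial v
  exact one_le_deg_of_adj hw

theorem sum_deg_of_isTree [Fintype V] {G : SimpleGraph V} (h : G.IsTree) :
    ∑ v, deg G v + 2 = 2 * Fintype.card V := by
  classical
  have h1 := h.card_edgeFinset
  have h2 := G.sum_degrees_eq_twice_card_edges
  simp only [deg_eq_degree]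
  omega

theorem nDeg_eq_sum [Fintype V] (G : SimpleGraph V) (i : ℕ) :
    nDeg G i = ∑ v, if deg G v = i then 1 else 0 := by
  classical
  rw [nDeg, Set.ncard_eq_toFinset_card', Finset.sum_boole]
  simp

theorem numBranching_eq_sum [Fintype V] (G : SimpleGraph V) :
    numBranching G = ∑ v, if 3 ≤ deg G v then 1 else 0 := by
  classical
  rw [numBranching, Set.ncard_eq_toFinset_card', Finset.sum_boole]
  simp

theorem IsChemicalTree.sum_nDeg [Fintype V] [Nontrivial V] {G : SimpleGraph V}
    (h : IsChemicalTree G) :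
    nDeg G 1 + nDeg G 2 + nDeg G 3 + nDeg G 4 = Fintype.card V := by
  simp only [nDeg_eq_sum, ← Finset.sum_add_distrib, Fintype.card_eq_sum_ones]
  refine Finset.sum_congr rfl fun v _ => ?_
  have h1 := one_le_deg_of_isTree h.1 v
  have h2 := h.2 v
  interval_cases deg G v <;> simp

theorem IsChemicalTree.sum_mul_nDeg [Fintype V] [Nontrivial V] {G : SimpleGraph V}
    (h : IsChemicalTree G) :
    nDeg G 1 + 2 * nDeg G 2 + 3 * nDeg G 3 + 4 * nDeg G 4 + 2 = 2 * Fintype.card V := by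
  rw [← sum_deg_of_isTree h.1]
  simp only [nDeg_eq_sum, Finset.mul_sum, ← Finset.sum_add_distrib]
  congr 1
  refine Finset.sum_congr rfl fun v _ => ?_
  have h1 := one_le_deg_of_isTree h.1 v
  have h2 := h.2 v
  interval_cases deg G v <;> simp

theorem IsChemicalTree.numBranching_eq [Fintype V] {G : SimpleGraph V}
    (h : IsChemicalTree G) : numBranching G = nDeg G 3 + nDeg G 4 := by
  simp only [nDeg_eq_sum, numBranching_eq_sum, ← Finset.sum_add_distrib]
  refine Finset.sum_congr rfl fun v _ => ?_
  have h2 := h.2 v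
  interval_cases deg G v <;> simp

/-- The graph obtained from `G` by moving the end vertex `u` of the edge `uw` to `v`. -/
def moveEdge (G : SimpleGraph V) (u w v : V) : SimpleGraph V :=
  G.deleteEdges {s(u, w)} ⊔ edge w v

theorem exists_adj_reachable_deleteEdges {G : SimpleGraph V} (hG : G.IsTree)
    {u v : V} (hu : 2 ≤ deg G u) :
    ∃ w, G.Adj u w ∧ (G.deleteEdges {s(u, w)}).Reachable u v := by
  obtain ⟨p, hp, -⟩ := hG.existsUnique_path u v
  obtain ⟨w, hw, hne⟩ := Set.exists_ne_of_one_lt_ncard (show 1 < (G.neighborSet u).ncard from hu)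
    p.snd
  refine ⟨w, hw, ⟨p.toDeleteEdge _ fun hmem => hne ?_⟩⟩
  exact hG.isAcyclic.eq_snd_of_adj_start hp hw (p.snd_mem_support_of_mem_edges hmem)

section moveEdge

variable {G : SimpleGraph V} {u v w : V}

theorem not_reachable_deleteEdges (hG : G.IsTree) (huw : G.Adj u w)
    (huv : (G.deleteEdges {s(u, w)}).Reachable u v) :
    ¬ (G.deleteEdges {s(u, w)}).Reachable w v := fun h =>
  isBridge_iff.1 (isAcyclic_iff_forall_adj_isBridge.1 hG.isAcyclic huw) (huv.trans h.symm)

theorem isTree_moveEdge (hG : G.IsTree) (huw : G.Adj u w)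
    (huv : (G.deleteEdges {s(u, w)}).Reachable u v) : (moveEdge G u w v).IsTree := by
  have hwv := not_reachable_deleteEdges hG huw huv
  have hne : w ≠ v := fun h => hwv (h ▸ Reachable.refl _)
  have := hG.connected.nonempty
  have huw' : (moveEdge G u w v).Reachable u w := by
    have hadj : (moveEdge G u w v).Adj v w := by simp [moveEdge, edge_adj, hne, hne.symm]
    exact (huv.mono le_sup_left).trans hadj.reachable
  have hadj : ∀ a b, G.Adj a b → (moveEdge G u w v).Reachable a b := by
    intro a b hab
    by_cases h : s(a, b) = s(u, w)
    · rcases Sym2.eq_iff.1 h with ⟨rfl, rfl⟩ | ⟨rfl, rfl⟩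
      · exact huw'
      · exact huw'.symm
    · refine Adj.reachable (Or.inl ?_)
      rw [deleteEdges_adj]
      exact ⟨hab, h⟩
  refine ⟨⟨fun a b => ?_⟩, ?_⟩
  · obtain ⟨p⟩ := hG.connected.preconnected a b
    induction p with
    | nil => exact Reachable.refl _
    | cons h _ ih => exact (hadj _ _ h).trans ih
  · exact (hG.isAcyclic.anti (deleteEdges_le _)).sup_edge_of_not_reachable hwv

theorem deg_moveEdge [Finite V] [DecidableEq V] (huw : G.Adj u w) (huv : u ≠ v)
    (hwv : w ≠ v) (hadj : ¬ G.Adj w v) :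
    deg (moveEdge G u w v) =
      Function.update (Function.update (deg G) u (deg G u - 1)) v (deg G v + 1) := by
  have hne := huw.ne
  funext x
  by_cases hxv : x = v
  · subst hxv
    have h : (moveEdge G u w x).neighborSet x = insert w (G.neighborSet x) := by
      ext y
      simp only [moveEdge, mem_neighborSet, sup_adj, deleteEdges_adj, edge_adj,
        Set.mem_singleton_iff, Sym2.eq_iff, Set.mem_insert_iff]
      grind
    rw [Function.update_self, deg, h, Set.ncard_insert_of_notMem (fun h => hadj h.symm)
      (Set.toFinite _), deg]
  rw [Function.update_of_ne hxv]
  by_cases hxu : x = u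
  · subst hxu
    have h : (moveEdge G x w v).neighborSet x = G.neighborSet x \ {w} := by
      ext y
      simp only [moveEdge, mem_neighborSet, sup_adj, deleteEdges_adj, edge_adj,
        Set.mem_singleton_iff, Sym2.eq_iff, Set.mem_sdiff]
      grind
    rw [Function.update_self, deg, h, Set.ncard_sdiff_singleton_of_mem (show w ∈ G.neighborSet _ from huw), deg]
  rw [Function.update_of_ne hxu]
  by_cases hxw : x = w
  · subst hxw
    have h : (moveEdge G u x v).neighborSet x = insert v (G.neighborSet x \ {u}) := by
      ext y
      simp only [moveEdge, mem_neighborSet, sup_adj, deleteEdges_adj, edge_adj,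
        Set.mem_singleton_iff, Sym2.eq_iff, Set.mem_sdiff, Set.mem_insert_iff]
      grind
    rw [deg, h, Set.ncard_insert_of_notMem (fun h => hadj h.1) (Set.toFinite _),
      Set.ncard_sdiff_singleton_add_one (show u ∈ G.neighborSet x from huw.symm)
        (Set.toFinite _), deg]
  · have h : (moveEdge G u w v).neighborSet x = G.neighborSet x := by
      ext y
      simp only [moveEdge, mem_neighborSet, sup_adj, deleteEdges_adj, edge_adj,
        Set.mem_singleton_iff, Sym2.eq_iff]
      grind
    rw [deg, h, deg]

end moveEdge

/-- A chemical tree having both a vertex of degree 2 and a vertex of degree 3 maximizes neither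
Zagreb index among the chemical trees with the same number of branching vertices. -/
theorem IsChemicalTree.exists_M1_lt_M2_lt [Fintype V] {G : SimpleGraph V}
    (hG : IsChemicalTree G) {u v : V} (hu : deg G u = 2) (hv : deg G v = 3) :
    ∃ G' : SimpleGraph V, IsChemicalTree G' ∧ numBranching G' = numBranching G ∧
      M1 G < M1 G' ∧ M2 G < M2 G' := by
  classical
  have huv : u ≠ v := by
    rintro rfl
    omega
  obtain ⟨w, huw, hreach⟩ := exists_adj_reachable_deleteEdges (v := v) hG.1 hu.ge
  have hnr := not_reachable_deleteEdges hG.1 huw hreach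
  have hwv : w ≠ v := fun h => hnr (h ▸ Reachable.refl _)
  have hHadj : ¬ (G.deleteEdges {s(u, w)}).Adj w v := fun h => hnr h.reachable
  have hadj : ¬ G.Adj w v := by
    intro h
    refine hHadj (deleteEdges_adj.2 ⟨h, ?_⟩)
    simp only [Set.mem_singleton_iff, Sym2.eq_iff]
    grind
  have hdeg := deg_moveEdge huw huv hwv hadj
  set d₀ := Function.update (deg G) u 1 with hd₀
  have hd₀u : d₀ u = 1 := by simp [d₀]
  have hd₀v : d₀ v = 3 := by simp [d₀, huv.symm, hv]
  have hd₀w : d₀ w = deg G w := by simp [d₀, huw.ne']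
  have hdegG : deg G = Function.update d₀ u (d₀ u + 1) := by
    rw [hd₀u, hd₀, Function.update_idem, one_add_one_eq_two, ← hu,
      Function.update_eq_self]
  replace hdeg : deg (moveEdge G u w v) = Function.update d₀ v (d₀ v + 1) := by
    rw [hdeg, hu, hv, hd₀v]
  have : Nontrivial V := ⟨u, v, huv⟩
  have hpos : ∀ y, 1 ≤ d₀ y := by
    intro y
    by_cases h : y = u
    · rw [h, hd₀u]
    · simpa [d₀, h] using one_le_deg_of_isTree hG.1 y
  have hle : ∀ y, d₀ y ≤ 4 := by
    intro y
    by_cases h : y = u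
    · rw [h, hd₀u]
      norm_num
    · simpa [d₀, h] using hG.2 y
  refine ⟨moveEdge G u w v, ⟨isTree_moveEdge hG.1 huw hreach, fun y => ?_⟩, ?_, ?_, ?_⟩
  · rw [hdeg]
    by_cases h : y = v
    · subst h
      simp [hd₀v]
    · simpa [h] using hle y
  · rw [numBranching, numBranching, hdeg]
    congr 1
    ext y
    by_cases h : y = v
    · subst h
      simp [hd₀v, hv]
    · by_cases h' : y = u
      · subst h'
        simp [h, hd₀u, hu]
      · simp [h, h', d₀]
  · have h1 : M1 G = ∑ y, d₀ y ^ 2 + (2 * d₀ u + 1) := by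
      rw [M1, hdegG, sum_sq_update_add_one]
    have h2 : M1 (moveEdge G u w v) = ∑ y, d₀ y ^ 2 + (2 * d₀ v + 1) := by
      rw [M1, hdeg, sum_sq_update_add_one]
    rw [h1, h2, hd₀u, hd₀v]
    omega
  · set H := G.deleteEdges {s(u, w)}
    have hGH : G = H ⊔ edge u w := by
      ext a b
      simp only [H, sup_adj, deleteEdges_adj, edge_adj, Set.mem_singleton_iff, Sym2.eq_iff]
      have := huw.symm
      have := huw.ne
      grind
    have hHuw : ¬ H.Adj u w := by simp [H]
    have h1 : M2 G = edgeWeight H (deg G) + deg G u * deg G w := by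
      rw [M2_eq_edgeWeight, ← edgeWeight_sup_edge H _ huw.ne hHuw, ← hGH]
    have h2 : M2 (moveEdge G u w v) =
        edgeWeight H (deg (moveEdge G u w v)) + d₀ w * 4 := by
      rw [M2_eq_edgeWeight, hdeg]
      nth_rw 1 [moveEdge]
      rw [edgeWeight_sup_edge H _ hwv hHadj, Function.update_of_ne hwv,
        Function.update_self, hd₀v]
    have hNu : (Set.toFinite (H.neighborSet u)).toFinset.card = 1 := by
      have h : H.neighborSet u = G.neighborSet u \ {w} := by
        ext y
        simp only [H, mem_neighborSet, deleteEdges_adj, Set.mem_singleton_iff, Sym2.eq_iff,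
          Set.mem_sdiff]
        grind
      rw [← Set.ncard_eq_toFinset_card, h, Set.ncard_sdiff_singleton_of_mem (show w ∈ G.neighborSet _ from huw)]
      change deg G u - 1 = 1
      omega
    have hNv : (Set.toFinite (H.neighborSet v)).toFinset.card = 3 := by
      have h : H.neighborSet v = G.neighborSet v := by
        ext y
        simp only [H, mem_neighborSet, deleteEdges_adj, Set.mem_singleton_iff, Sym2.eq_iff]
        grind
      rw [← Set.ncard_eq_toFinset_card, h]
      exact hv
    have hsu : ∑ y ∈ (Set.toFinite (H.neighborSet u)).toFinset, d₀ y ≤ 4 :=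
      (Finset.sum_le_card_nsmul _ _ 4 fun y _ => hle y).trans_eq (by rw [hNu, one_nsmul])
    have hsv : 3 ≤ ∑ y ∈ (Set.toFinite (H.neighborSet v)).toFinset, d₀ y :=
      (Finset.card_nsmul_le_sum _ _ 1 fun y _ => hpos y).trans_eq' (by rw [hNv]; rfl)
    have hw := hpos w
    rw [h1, h2, hdeg, edgeWeight_update_add_one, hu, ← hd₀w]
    nth_rw 1 [hdegG]
    rw [edgeWeight_update_add_one]
    omega

end ChemTree

theorem stmt_12 {V : Type*} [Fintype V] (n b : ℕ)
    (hcard : Fintype.card V = n) (hb1 : 1 ≤ b) (hb2 : (b : ℚ) < (n : ℚ) / 2 - 1)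
    (T : SimpleGraph V) (hT : IsChemicalTree T) (hbr : numBranching T = b)
    (hmax : (∀ T' : SimpleGraph V, IsChemicalTree T' → numBranching T' = b →
        M1 T' ≤ M1 T) ∨
      (∀ T' : SimpleGraph V, IsChemicalTree T' → numBranching T' = b →
        M2 T' ≤ M2 T)) :
    (0 < nDeg T 2 →
      nDeg T 1 = 2 * b + 2 ∧ (nDeg T 2 : ℚ) = (n : ℚ) - 3 * b - 2 ∧
        nDeg T 3 = 0 ∧ nDeg T 4 = b) ∧
    (nDeg T 2 = 0 ↔
      ((nDeg T 1 : ℚ) = (n : ℚ) - b ∧ (nDeg T 3 : ℚ) = 3 * (b : ℚ) - n + 2 ∧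
        (nDeg T 4 : ℚ) = (n : ℚ) - 2 * b - 2)) := by
  have hn : 2 * b + 2 < n := by
    have : (2 * b + 2 : ℚ) < n := by linarith
    exact_mod_cast this
  have : Nontrivial V := Fintype.one_lt_card_iff_nontrivial.1 (by omega)
  have hcount := hT.sum_nDeg
  have hsum := hT.sum_mul_nDeg
  have hbranch := hT.numBranching_eq
  rw [hcard] at hcount hsum
  rw [hbr] at hbranch
  have hzero : 0 < nDeg T 2 → nDeg T 3 = 0 := by
    intro h2
    by_contra h3
    obtain ⟨u, hu⟩ := (Set.ncard_pos (Set.toFinite _)).1 h2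
    obtain ⟨v, hv⟩ := (Set.ncard_pos (Set.toFinite _)).1 (Nat.pos_of_ne_zero h3)
    obtain ⟨T', hT', hbr', hM1, hM2⟩ := hT.exists_M1_lt_M2_lt hu hv
    rcases hmax with h | h
    · exact (h T' hT' (hbr'.trans hbr)).not_gt hM1
    · exact (h T' hT' (hbr'.trans hbr)).not_gt hM2
  qify at hcount hsum hbranch
  refine ⟨fun h2 => ?_, fun h2 => ?_, fun ⟨h1, h3, h4⟩ => ?_⟩
  · have h3 := hzero h2
    have h3' : (nDeg T 3 : ℚ) = 0 := by exact_mod_cast h3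
    refine ⟨?_, by linarith, h3, ?_⟩
    · have : (nDeg T 1 : ℚ) = 2 * b + 2 := by linarith
      exact_mod_cast this
    · have : (nDeg T 4 : ℚ) = b := by linarith
      exact_mod_cast this
  · have h2' : (nDeg T 2 : ℚ) = 0 := by exact_mod_cast h2
    exact ⟨by linarith, by linarith, by linarith⟩
  · have : (nDeg T 2 : ℚ) = 0 := by linarith
    exact_mod_cast this
end

section
/- Let 1 ≤ b < n/2 − 1 and let T be an n-vertex chemical tree with exactly b branching vertices such that M2(T') ≤ M2(T) for every n-vertex chemical tree T' with exactly b branching vertices. Then every vertex of degree 3 in T (if any exists) has at most one neighbor of degree 4. -/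
open SimpleGraph

open ChemTree

namespace ChemTree

variable {V : Type*}

/-- The graph obtained from `G` by replacing the edges `vu` and `yw` by `yu` and `vw`. -/
def switch (G : SimpleGraph V) (v u y w : V) : SimpleGraph V :=
  fromEdgeSet (insert s(y, u) (insert s(v, w) (G.edgeSet \ {s(v, u), s(y, w)})))

section Switch

variable {G : SimpleGraph V} {v u y w : V}

lemma switch_adj (hyu : y ≠ u) (hvw : v ≠ w) {a c : V} :
    (switch G v u y w).Adj a c ↔
      s(a, c) = s(y, u) ∨ s(a, c) = s(v, w) ∨
        G.Adj a c ∧ s(a, c) ≠ s(v, u) ∧ s(a, c) ≠ s(y, w) := by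
  simp only [switch, fromEdgeSet_adj, Set.mem_insert_iff, Set.mem_sdiff, mem_edgeSet,
    Set.mem_singleton_iff, not_or]
  constructor
  · exact fun h => h.1
  · refine fun h => ⟨h, ?_⟩
    rintro rfl
    rcases h with h | h | h
    · simp only [Sym2.eq_iff] at h; grind
    · simp only [Sym2.eq_iff] at h; grind
    · exact h.1.ne rfl

lemma edgeSet_switch (hyu : y ≠ u) (hvw : v ≠ w) :
    (switch G v u y w).edgeSet =
      insert s(y, u) (insert s(v, w) (G.edgeSet \ {s(v, u), s(y, w)})) := by
  ext e
  induction e with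
  | _ a c => simp [switch_adj hyu hvw]

lemma deg_switch [Finite V] (hvu : G.Adj v u) (hyw : G.Adj y w) (nyu : ¬ G.Adj y u)
    (nvw : ¬ G.Adj v w) (hvy : v ≠ y) (huw : u ≠ w) (hyu : y ≠ u) (hvw : v ≠ w) (a : V) :
    deg (switch G v u y w) a = deg G a := by
  have key : ∀ p q : V, p ∉ G.neighborSet a → q ∈ G.neighborSet a →
      (switch G v u y w).neighborSet a = insert p (G.neighborSet a \ {q}) →
      deg (switch G v u y w) a = deg G a := by
    intro p q hp hq h
    rw [deg, deg, h, Set.ncard_exchange hp hq]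
  have h1 := hvu.symm
  have h2 := hyw.symm
  have h3 : ¬ G.Adj u y := fun h => nyu h.symm
  have h4 : ¬ G.Adj w v := fun h => nvw h.symm
  have h5 := hvu.ne
  have h6 := hyw.ne
  by_cases hav : a = v
  · subst hav
    refine key w u nvw hvu ?_
    ext c
    simp only [mem_neighborSet, switch_adj hyu hvw, Set.mem_insert_iff, Set.mem_sdiff,
      Set.mem_singleton_iff, Sym2.eq_iff, ne_eq]
    grind
  by_cases hau : a = u
  · subst hau
    refine key y v h3 h1 ?_
    ext c
    simp only [mem_neighborSet, switch_adj hyu hvw, Set.mem_insert_iff, Set.mem_sdiff,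
      Set.mem_singleton_iff, Sym2.eq_iff, ne_eq]
    grind
  by_cases hay : a = y
  · subst hay
    refine key u w nyu hyw ?_
    ext c
    simp only [mem_neighborSet, switch_adj hyu hvw, Set.mem_insert_iff, Set.mem_sdiff,
      Set.mem_singleton_iff, Sym2.eq_iff, ne_eq]
    grind
  by_cases haw : a = w
  · subst haw
    refine key v y h4 h2 ?_
    ext c
    simp only [mem_neighborSet, switch_adj hyu hvw, Set.mem_insert_iff, Set.mem_sdiff,
      Set.mem_singleton_iff, Sym2.eq_iff, ne_eq]
    grind
  · have : (switch G v u y w).neighborSet a = G.neighborSet a := by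
      ext c
      simp only [mem_neighborSet, switch_adj hyu hvw, Sym2.eq_iff, ne_eq]
      grind
    rw [deg, deg, this]

lemma sum_edgeSet_switch [Finite V] (hvu : G.Adj v u) (hyw : G.Adj y w) (nyu : ¬ G.Adj y u)
    (nvw : ¬ G.Adj v w) (hyu : y ≠ u) (hvw : v ≠ w) (f : Sym2 V → ℕ) :
    ∑ e ∈ (Set.toFinite (switch G v u y w).edgeSet).toFinset, f e + (f s(v, u) + f s(y, w)) =
      ∑ e ∈ (Set.toFinite G.edgeSet).toFinset, f e + (f s(y, u) + f s(v, w)) := by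
  classical
  have h5 := hvu.ne
  have hne : s(v, u) ≠ s(y, w) := by
    simp only [ne_eq, Sym2.eq_iff]; grind
  have hne' : s(y, u) ≠ s(v, w) := by
    simp only [ne_eq, Sym2.eq_iff]; grind
  set F := (Set.toFinite G.edgeSet).toFinset with hF
  have hF' : (Set.toFinite (switch G v u y w).edgeSet).toFinset =
      insert s(y, u) (insert s(v, w) (F \ {s(v, u), s(y, w)})) := by
    ext e
    simp [hF, edgeSet_switch hyu hvw]
  have hsub : {s(v, u), s(y, w)} ⊆ F := by
    intro e he
    simp only [Finset.mem_insert, Finset.mem_singleton] at he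
    rcases he with rfl | rfl <;> simpa [hF]
  have hsum := Finset.sum_sdiff (f := f) hsub
  rw [Finset.sum_pair hne] at hsum
  rw [hF', Finset.sum_insert (by simp [hF, hne', nyu]), Finset.sum_insert (by simp [hF, nvw]),
    ← hsum]
  ring

lemma isTree_switch [Finite V] (hG : G.IsTree) (hvu : G.Adj v u) (hyw : G.Adj y w)
    (nyu : ¬ G.Adj y u) (nvw : ¬ G.Adj v w) (hyu : y ≠ u) (hvw : v ≠ w)
    (p : G.Walk v y) (hu : u ∉ p.support) (hw : w ∉ p.support) :
    (switch G v u y w).IsTree := by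
  classical
  have hadj {a c : V} := switch_adj (G := G) (a := a) (c := c) hyu hvw
  have hreach : (switch G v u y w).Reachable v y := by
    refine ⟨p.transfer _ fun e he => ?_⟩
    induction e with
    | _ a c =>
      have ha := p.fst_mem_support_of_mem_edges he
      have hc := p.snd_mem_support_of_mem_edges he
      rw [mem_edgeSet, hadj]
      refine .inr (.inr ⟨p.adj_of_mem_edges he, ?_, ?_⟩) <;>
      · simp only [ne_eq, Sym2.eq_iff]
        grind
  have hyu' : (switch G v u y w).Adj y u := hadj.2 (.inl rfl)
  have hvw' : (switch G v u y w).Adj v w := hadj.2 (.inr (.inl rfl))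
  have hvu' : (switch G v u y w).Reachable v u := hreach.trans hyu'.reachable
  have hyw' : (switch G v u y w).Reachable y w := hreach.symm.trans hvw'.reachable
  have step : ∀ a c, G.Adj a c → (switch G v u y w).Reachable a c := by
    intro a c h
    by_cases h1 : s(a, c) = s(v, u)
    · rcases Sym2.eq_iff.1 h1 with ⟨rfl, rfl⟩ | ⟨rfl, rfl⟩
      exacts [hvu', hvu'.symm]
    by_cases h2 : s(a, c) = s(y, w)
    · rcases Sym2.eq_iff.1 h2 with ⟨rfl, rfl⟩ | ⟨rfl, rfl⟩
      exacts [hyw', hyw'.symm]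
    exact (hadj.2 (.inr (.inr ⟨h, h1, h2⟩))).reachable
  rw [isTree_iff_connected_and_card] at hG ⊢
  have hne := hG.1.nonempty
  refine ⟨⟨fun a c => ?_⟩, ?_⟩
  · obtain ⟨q⟩ := hG.1.preconnected a c
    induction q with
    | nil => rfl
    | cons h _ ih => exact (step _ _ h).trans ih
  · have h := sum_edgeSet_switch hvu hyw nyu nvw hyu hvw fun _ => 1
    simp only [Finset.sum_const, smul_eq_mul, mul_one] at h
    rw [← hG.2, Nat.card_coe_set_eq, Nat.card_coe_set_eq, Set.ncard_eq_toFinset_card _,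
      Set.ncard_eq_toFinset_card _]
    omega

lemma M2_switch [Fintype V] (hvu : G.Adj v u) (hyw : G.Adj y w) (nyu : ¬ G.Adj y u)
    (nvw : ¬ G.Adj v w) (hvy : v ≠ y) (huw : u ≠ w) (hyu : y ≠ u) (hvw : v ≠ w) :
    M2 (switch G v u y w) + (deg G v * deg G u + deg G y * deg G w) =
      M2 G + (deg G y * deg G u + deg G v * deg G w) := by
  unfold M2
  simp only [deg_switch hvu hyw nyu nvw hvy huw hyu hvw]
  exact sum_edgeSet_switch hvu hyw nyu nvw hyu hvw
    (Sym2.lift ⟨fun u w => deg G u * deg G w, fun u w => Nat.mul_comm _ _⟩)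

end Switch

/-- If some vertex of a finite tree has degree `d ≥ 2`, then there is a path from `v` to a vertex
of degree `d` having a neighbor of degree `≠ d` off this path. -/
lemma exists_isPath_adj_deg_ne [Finite V] {G : SimpleGraph V} (hG : G.IsTree) (v : V) {d : ℕ}
    (hd : 2 ≤ d) (hex : ∃ x, deg G x = d) :
    ∃ (y w : V) (p : G.Walk v y), p.IsPath ∧ deg G y = d ∧ G.Adj y w ∧ w ∉ p.support ∧
      deg G w ≠ d := by
  classical
  obtain ⟨y, hy, hmax⟩ := Set.exists_max_image {x | deg G x = d} (G.dist v) (Set.toFinite _) hex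
  obtain ⟨p, hp, hlen⟩ := hG.connected.exists_path_of_dist v y
  obtain ⟨w, hw, hwp⟩ : ∃ w ∈ G.neighborSet y, w ≠ p.penultimate := by
    apply Set.exists_ne_of_one_lt_ncard
    have : (G.neighborSet y).ncard = d := hy
    omega
  rw [mem_neighborSet] at hw
  have hws : w ∉ p.support := fun h => hwp (hG.isAcyclic.eq_penultimate_of_adj_end hp hw h)
  refine ⟨y, w, p, hp, hy, hw, hws, fun hdw => ?_⟩
  obtain ⟨q, hq, hqlen⟩ := hG.connected.exists_path_of_dist v w
  have hqp : q = p.concat hw := congrArg Subtype.val <|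
    (hG.isAcyclic.subsingleton_path v w).elim ⟨q, hq⟩ ⟨_, hp.concat hws hw⟩
  rw [hqp, Walk.length_concat] at hqlen
  have := hmax w hdw
  omega

end ChemTree

theorem stmt_17 {V : Type*} [Fintype V] (n b : ℕ)
    (hcard : Fintype.card V = n) (hb1 : 1 ≤ b) (hb2 : (b : ℚ) < (n : ℚ) / 2 - 1)
    (T : SimpleGraph V) (hT : IsChemicalTree T) (hbr : numBranching T = b)
    (hmax : ∀ T' : SimpleGraph V, IsChemicalTree T' → numBranching T' = b →
      M2 T' ≤ M2 T) :
    ∀ v : V, deg T v = 3 → {w | T.Adj v w ∧ deg T w = 4}.ncard ≤ 1 := by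
  intro v hv
  by_contra! hlt
  obtain ⟨x, hx⟩ : {w | T.Adj v w ∧ deg T w = 4}.Nonempty :=
    Set.nonempty_of_ncard_ne_zero (by omega)
  obtain ⟨y, w, p, hp, hy, hyw, hwp, hw4⟩ :=
    exists_isPath_adj_deg_ne hT.1 v (d := 4) (by norm_num) ⟨x, hx.2⟩
  obtain ⟨u, ⟨hvu, hu⟩, hup⟩ := Set.exists_ne_of_one_lt_ncard hlt p.snd
  have hup : u ∉ p.support := fun h => hup (hT.1.isAcyclic.eq_snd_of_adj_start hp hvu h)
  have hvy : v ≠ y := by rintro rfl; omega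
  have hyu : y ≠ u := by rintro rfl; exact hup p.end_mem_support
  have hvw : v ≠ w := by rintro rfl; exact hwp p.start_mem_support
  have huw : u ≠ w := by rintro rfl; exact hw4 hu
  have nadj : ∀ a, a ∉ p.support → T.Adj y a → ¬ T.Adj v a := fun a ha hya hva =>
    hvy <| (hT.1.isAcyclic.eq_penultimate_of_adj_end (hp.concat ha hya) hva.symm
      (Walk.start_mem_support _)).trans (Walk.penultimate_concat p hya)
  have nyu : ¬ T.Adj y u := fun h => nadj u hup h hvu
  have nvw : ¬ T.Adj v w := nadj w hwp hyw
  have hdeg := deg_switch hvu hyw nyu nvw hvy huw hyu hvw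
  have hle := hmax (switch T v u y w)
    ⟨isTree_switch hT.1 hvu hyw nyu nvw hyu hvw p hup hwp, fun a => hdeg a ▸ hT.2 a⟩
    (by simpa only [numBranching, hdeg] using hbr)
  have hM := M2_switch hvu hyw nyu nvw hvy huw hyu hvw
  have := hT.2 w
  rw [hv, hu, hy] at hM
  omega
end
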